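/- Let g be a C³ metric on U, V = (V_μ) a C³ covector field, and G : U → ℝ a C² positive function satisfying the continuity equation ∇_μ(G V^μ) = 0 on U, where ∇_μ V^μ := ∂_μ V^μ + Γ^μ_{μκ}V^κ. Then on U: □‖V‖² = −2(∇_ν V_μ)(∇^ν V^μ) − 2 V^μ[ R_{σμ}V^σ + ∇^λ ω_{λμ} − (1/G)( ∇_μ(D_V G) + (∇_ν V^ν)(∇_μ G) ) ], where □f := g^{μν}(∂_μ∂_ν f − Γ^λ_{μν}∂_λ f) for scalars f, ∇_ν V_μ := ∂_ν V_μ − Γ^κ_{νμ}V_κ, ∇^ν V^μ := g^{νκ}(∂_κ V^μ + Γ^μ_{κρ}V^ρ), ∇^λ ω_{λμ} := g^{λκ}( ∂_κ ω_{λμ} − Γ^ρ_{κλ}ω_{ρμ} − Γ^ρ_{κμ}ω_{λρ} ), and ∇_μ of a scalar means ∂_μ. -/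

import Mathlib

noncomputable section

/-- Points of spacetime: coordinates (x⁰,x¹,x²,x³). -/
abbrev Vec4 : Type := Fin 4 → ℝ

/-- Partial derivative ∂_μ f. -/
def pd (μ : Fin 4) (f : Vec4 → ℝ) (x : Vec4) : ℝ := fderiv ℝ f x (Pi.single μ 1)

/-- Christoffel symbols Γ^l_{μν} of the metric g, with pointwise inverse ginv. -/
def Chris (g ginv : Vec4 → Fin 4 → Fin 4 → ℝ) (l μ ν : Fin 4) (x : Vec4) : ℝ :=
  (1 / 2) * ∑ κ, ginv x l κ *
    (pd μ (fun y => g y κ ν) x + pd ν (fun y => g y κ μ) x - pd κ (fun y => g y μ ν) x)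

/-- Raised index V^μ := g^{μν} V_ν. -/
def Vup (ginv : Vec4 → Fin 4 → Fin 4 → ℝ) (V : Vec4 → Fin 4 → ℝ) (μ : Fin 4) (x : Vec4) : ℝ :=
  ∑ ν, ginv x μ ν * V x ν

/-- ‖V‖² := −g^{μν} V_μ V_ν. -/
def normSq (ginv : Vec4 → Fin 4 → Fin 4 → ℝ) (V : Vec4 → Fin 4 → ℝ) (x : Vec4) : ℝ :=
  -∑ μ, ∑ ν, ginv x μ ν * V x μ * V x ν

/-- Vorticity two-form ω_{μν} := ∂_μ V_ν − ∂_ν V_μ. -/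
def vort (V : Vec4 → Fin 4 → ℝ) (μ ν : Fin 4) (x : Vec4) : ℝ :=
  pd μ (fun y => V y ν) x - pd ν (fun y => V y μ) x

/-- Covariant derivative of a covector: ∇_ν V_μ := ∂_ν V_μ − Γ^κ_{νμ} V_κ. -/
def covD (g ginv : Vec4 → Fin 4 → Fin 4 → ℝ) (V : Vec4 → Fin 4 → ℝ) (ν μ : Fin 4) (x : Vec4) : ℝ :=
  pd ν (fun y => V y μ) x - ∑ κ, Chris g ginv κ ν μ x * V x κ

/-- ∇^ν V^μ := g^{νκ}(∂_κ V^μ + Γ^μ_{κρ} V^ρ). -/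
def covDupUp (g ginv : Vec4 → Fin 4 → Fin 4 → ℝ) (V : Vec4 → Fin 4 → ℝ) (ν μ : Fin 4) (x : Vec4) : ℝ :=
  ∑ κ, ginv x ν κ *
    (pd κ (fun y => Vup ginv V μ y) x + ∑ ρ, Chris g ginv μ κ ρ x * Vup ginv V ρ x)

/-- Riemann curvature R^l{}_{σμν} := ∂_μ Γ^l_{νσ} − ∂_ν Γ^l_{μσ} + Γ^l_{μκ}Γ^κ_{νσ} − Γ^l_{νκ}Γ^κ_{μσ}. -/
def Riem (g ginv : Vec4 → Fin 4 → Fin 4 → ℝ) (l σ μ ν : Fin 4) (x : Vec4) : ℝ :=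
  pd μ (fun y => Chris g ginv l ν σ y) x - pd ν (fun y => Chris g ginv l μ σ y) x
    + (∑ κ, Chris g ginv l μ κ x * Chris g ginv κ ν σ x)
    - ∑ κ, Chris g ginv l ν κ x * Chris g ginv κ μ σ x

/-- Ricci curvature R_{σν} := R^μ{}_{σμν}. -/
def RicciT (g ginv : Vec4 → Fin 4 → Fin 4 → ℝ) (σ ν : Fin 4) (x : Vec4) : ℝ :=
  ∑ μ, Riem g ginv μ σ μ ν x

/-- ∇^λ ω_{λμ} := g^{λκ}(∂_κ ω_{λμ} − Γ^ρ_{κλ} ω_{ρμ} − Γ^ρ_{κμ} ω_{λρ}). -/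
def divVort (g ginv : Vec4 → Fin 4 → Fin 4 → ℝ) (V : Vec4 → Fin 4 → ℝ) (μ : Fin 4) (x : Vec4) : ℝ :=
  ∑ l, ∑ κ, ginv x l κ *
    (pd κ (fun y => vort V l μ y) x
      - (∑ ρ, Chris g ginv ρ κ l x * vort V ρ μ x)
      - ∑ ρ, Chris g ginv ρ κ μ x * vort V l ρ x)

/-- ∇_μ V^μ := ∂_μ V^μ + Γ^μ_{μκ} V^κ. -/
def divUp (g ginv : Vec4 → Fin 4 → Fin 4 → ℝ) (V : Vec4 → Fin 4 → ℝ) (x : Vec4) : ℝ :=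
  ∑ μ, (pd μ (fun y => Vup ginv V μ y) x + ∑ κ, Chris g ginv μ μ κ x * Vup ginv V κ x)

/-- D_V G := V^μ ∂_μ G. -/
def DVf (ginv : Vec4 → Fin 4 → Fin 4 → ℝ) (V : Vec4 → Fin 4 → ℝ) (G : Vec4 → ℝ) (x : Vec4) : ℝ :=
  ∑ μ, Vup ginv V μ x * pd μ G x

/-- Scalar wave operator □f := g^{μν}(∂_μ∂_ν f − Γ^λ_{μν}∂_λ f). -/
def box (g ginv : Vec4 → Fin 4 → Fin 4 → ℝ) (f : Vec4 → ℝ) (x : Vec4) : ℝ :=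
  ∑ μ, ∑ ν, ginv x μ ν * (pd μ (pd ν f) x - ∑ l, Chris g ginv l μ ν x * pd l f x)

theorem hp_pd_add {f h : Vec4 → ℝ} {x : Vec4} (μ : Fin 4) (hf : DifferentiableAt ℝ f x)
    (hh : DifferentiableAt ℝ h x) : pd μ (fun y => f y + h y) x = pd μ f x + pd μ h x := by
  simp only [pd]
  rw [fderiv_fun_add hf hh]; rfl

theorem hp_pd_sub {f h : Vec4 → ℝ} {x : Vec4} (μ : Fin 4) (hf : DifferentiableAt ℝ f x)
    (hh : DifferentiableAt ℝ h x) : pd μ (fun y => f y - h y) x = pd μ f x - pd μ h x := by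
  simp only [pd]
  rw [fderiv_fun_sub hf hh]; rfl

theorem hp_pd_mul {f h : Vec4 → ℝ} {x : Vec4} (μ : Fin 4) (hf : DifferentiableAt ℝ f x)
    (hh : DifferentiableAt ℝ h x) :
    pd μ (fun y => f y * h y) x = pd μ f x * h x + f x * pd μ h x := by
  simp only [pd]
  rw [fderiv_fun_mul hf hh]
  simp
  ring

theorem hp_pd_sum {f : Fin 4 → Vec4 → ℝ} {x : Vec4} (μ : Fin 4)
    (hf : ∀ i, DifferentiableAt ℝ (f i) x) :
    pd μ (fun y => ∑ i, f i y) x = ∑ i, pd μ (f i) x := by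
  simp only [pd]
  rw [fderiv_fun_sum (fun i _ => hf i)]
  simp

theorem hp_pd_const_mul {f : Vec4 → ℝ} {x : Vec4} (μ : Fin 4) (c : ℝ)
    (hf : DifferentiableAt ℝ f x) : pd μ (fun y => c * f y) x = c * pd μ f x := by
  rw [hp_pd_mul μ (by fun_prop) hf]
  simp [pd]

theorem hp_pd_sum_mul {f h : Fin 4 → Vec4 → ℝ} {x : Vec4} (μ : Fin 4)
    (hf : ∀ i, DifferentiableAt ℝ (f i) x) (hh : ∀ i, DifferentiableAt ℝ (h i) x) :
    pd μ (fun y => ∑ i, f i y * h i y) x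
      = ∑ i, (pd μ (f i) x * h i x + f i x * pd μ (h i) x) := by
  rw [hp_pd_sum μ (fun i => (hf i).fun_mul (hh i))]
  exact Finset.sum_congr rfl (fun i _ => hp_pd_mul μ (hf i) (hh i))

theorem hp_pd_congr {U : Set Vec4} (hU : IsOpen U) {f h : Vec4 → ℝ} (hfh : ∀ y ∈ U, f y = h y)
    {x : Vec4} (hx : x ∈ U) (μ : Fin 4) : pd μ f x = pd μ h x := by
  simp only [pd]
  rw [Filter.EventuallyEq.fderiv_eq]
  filter_upwards [hU.mem_nhds hx] with y hy using hfh y hy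

theorem hp_pd_contDiffOn {U : Set Vec4} (hU : IsOpen U) {f : Vec4 → ℝ} {n m : WithTop ℕ∞}
    (hf : ContDiffOn ℝ n f U) (hmn : m + 1 ≤ n) (μ : Fin 4) : ContDiffOn ℝ m (pd μ f) U := by
  have := hf.fderiv_of_isOpen hU hmn
  exact this.clm_apply contDiffOn_const

theorem hp_pd_comm {U : Set Vec4} (hU : IsOpen U) {f : Vec4 → ℝ}
    (hf : ContDiffOn ℝ 2 f U) {x : Vec4} (hx : x ∈ U) (μ ν : Fin 4) :
    pd μ (pd ν f) x = pd ν (pd μ f) x := by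
  have hfa : ContDiffAt ℝ 2 f x := hf.contDiffAt (hU.mem_nhds hx)
  have hs : IsSymmSndFDerivAt ℝ f x := hfa.isSymmSndFDerivAt (by simp)
  have hd : DifferentiableAt ℝ (fderiv ℝ f) x :=
    (hfa.fderiv_right (m := 1) (by norm_num)).differentiableAt (by norm_num)
  have key : ∀ a b : Fin 4, pd a (pd b f) x
      = fderiv ℝ (fderiv ℝ f) x (Pi.single a 1) (Pi.single b 1) := by
    intro a b
    change fderiv ℝ (fun y => fderiv ℝ f y (Pi.single b 1)) x (Pi.single a 1) = _
    rw [fderiv_clm_apply hd (by fun_prop)]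
    simp
  rw [key, key]
  exact hs _ _

theorem hp_det_contDiffOn {U : Set Vec4} {M : Vec4 → Matrix (Fin 4) (Fin 4) ℝ}
    (hM : ∀ i j, ContDiffOn ℝ 3 (fun x => M x i j) U) :
    ContDiffOn ℝ 3 (fun x => (M x).det) U := by
  simp only [Matrix.det_apply]
  refine ContDiffOn.sum (fun σ _ => ?_)
  refine ContDiffOn.const_smul _ ?_
  exact contDiffOn_prod (fun i _ => hM _ _)

theorem hp_ginv_contDiffOn {U : Set Vec4} {g ginv : Vec4 → Fin 4 → Fin 4 → ℝ}
    (hinv : ∀ x ∈ U, (Matrix.of (g x)) * (Matrix.of (ginv x)) = 1)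
    (hg : ∀ μ ν, ContDiffOn ℝ 3 (fun x => g x μ ν) U) (μ ν : Fin 4) :
    ContDiffOn ℝ 3 (fun x => ginv x μ ν) U := by
  have h1 : ContDiffOn ℝ 3 (fun x => ((Matrix.of (g x)).det)⁻¹ * (Matrix.of (g x)).adjugate μ ν) U := by
    refine ContDiffOn.mul (ContDiffOn.inv (hp_det_contDiffOn (by simpa using hg)) ?_) ?_
    · intro x hx h0
      have := congrArg Matrix.det (hinv x hx)
      rw [Matrix.det_mul, h0] at this
      simp at this
    · simp only [Matrix.adjugate_apply]
      apply hp_det_contDiffOn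
      intro i j
      simp only [Matrix.updateRow_apply]
      split_ifs
      · exact contDiffOn_const
      · exact hg i j
  refine h1.congr (fun x hx => ?_)
  have h2 := Matrix.inv_eq_right_inv (hinv x hx)
  have h3 : ginv x μ ν = (Matrix.of (g x))⁻¹ μ ν := by rw [h2]; rfl
  rw [h3, Matrix.inv_def]
  simp

/-- Lowering the first index of the Christoffel symbols. -/
theorem hp_compat (M N : Matrix (Fin 4) (Fin 4) ℝ) (hMN : M * N = 1)
    (dg : Fin 4 → Fin 4 → Fin 4 → ℝ) (hdg : ∀ a b c, dg a b c = dg a c b)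
    (Γ : Fin 4 → Fin 4 → Fin 4 → ℝ)
    (hΓ : ∀ l μ ν, Γ l μ ν = (1 / 2) * ∑ κ, N l κ * (dg μ κ ν + dg ν κ μ - dg κ μ ν))
    (κ : Fin 4) :
    Matrix.of (dg κ) = M * Matrix.of (fun l μ => Γ l κ μ)
      + (M * Matrix.of (fun l μ => Γ l κ μ)).transpose := by
  have e : Matrix.of (fun l μ => Γ l κ μ)
      = N * Matrix.of (fun α μ => (1 / 2) * (dg κ α μ + dg μ α κ - dg α κ μ)) := by
    ext l μ
    simp only [Matrix.of_apply, Matrix.mul_apply, hΓ, Finset.mul_sum]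
    exact Finset.sum_congr rfl (fun i _ => by ring)
  rw [e, ← Matrix.mul_assoc, hMN, Matrix.one_mul]
  ext a b
  simp only [Matrix.of_apply, Matrix.add_apply, Matrix.transpose_apply]
  rw [hdg κ b a, hdg b a κ, hdg a b κ]
  ring

theorem hp_compat_inv (M N dM dN P : Matrix (Fin 4) (Fin 4) ℝ) (hMN : M * N = 1)
    (hM : M.transpose = M) (hd : dM * N + M * dN = 0)
    (hdM : dM = M * P + (M * P).transpose) :
    dN = - (P * N) - N * P.transpose := by
  have hNM : N * M = 1 := mul_eq_one_comm.mp hMN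
  have h1 : dN = - (N * (dM * N)) := by
    have : N * (dM * N + M * dN) = 0 := by rw [hd, Matrix.mul_zero]
    rw [Matrix.mul_add, ← Matrix.mul_assoc N M, hNM, Matrix.one_mul] at this
    exact eq_neg_of_add_eq_zero_right this
  rw [h1, hdM, Matrix.transpose_mul, hM, Matrix.add_mul, Matrix.mul_add, Matrix.mul_assoc P.transpose,
    hMN, Matrix.mul_one, Matrix.mul_assoc M, ← Matrix.mul_assoc N M, hNM, Matrix.one_mul]
  abel

/-- The mixed covariant derivative ∇_ν V^μ. -/
def hpA (g ginv : Vec4 → Fin 4 → Fin 4 → ℝ) (V : Vec4 → Fin 4 → ℝ) (ν μ : Fin 4) (x : Vec4) : ℝ :=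
  pd ν (fun y => Vup ginv V μ y) x + ∑ ρ, Chris g ginv μ ν ρ x * Vup ginv V ρ x

/-- Second covariant derivative of the covector (algebraic form). -/
def hpC (Γ : Fin 4 → Fin 4 → Fin 4 → ℝ) (B : Fin 4 → Fin 4 → ℝ)
    (dB : Fin 4 → Fin 4 → Fin 4 → ℝ) (κ ν μ : Fin 4) : ℝ :=
  dB κ ν μ - (∑ ρ, Γ ρ κ ν * B ρ μ) - ∑ ρ, Γ ρ κ μ * B ν ρ

/-- Second covariant derivative of the vector (algebraic form). -/
def hpE (Γ : Fin 4 → Fin 4 → Fin 4 → ℝ) (A : Fin 4 → Fin 4 → ℝ)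
    (dA : Fin 4 → Fin 4 → Fin 4 → ℝ) (κ ν μ : Fin 4) : ℝ :=
  dA κ ν μ - (∑ ρ, Γ ρ κ ν * A ρ μ) + ∑ ρ, Γ μ κ ρ * A ν ρ

theorem hp_E_eq_C (Γ : Fin 4 → Fin 4 → Fin 4 → ℝ) (N A B : Fin 4 → Fin 4 → ℝ)
    (dA dB dN : Fin 4 → Fin 4 → Fin 4 → ℝ)
    (hA : ∀ ν μ, A ν μ = ∑ α, N μ α * B ν α)
    (hdA : ∀ κ ν μ, dA κ ν μ = ∑ α, (dN κ μ α * B ν α + N μ α * dB κ ν α))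
    (hdN : ∀ κ μ ν, dN κ μ ν = - (∑ l, Γ μ κ l * N l ν) - ∑ l, N μ l * Γ ν κ l)
    (κ ν μ : Fin 4) : hpE Γ A dA κ ν μ = ∑ α, N μ α * hpC Γ B dB κ ν α := by
  simp only [hpE, hpC, hdA, hdN, hA, Fin.sum_univ_four]
  ring

theorem hp_ricci_identity (Γ : Fin 4 → Fin 4 → Fin 4 → ℝ) (W : Fin 4 → ℝ)
    (A dW : Fin 4 → Fin 4 → ℝ)
    (dA ddW : Fin 4 → Fin 4 → Fin 4 → ℝ) (dΓ : Fin 4 → Fin 4 → Fin 4 → Fin 4 → ℝ)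
    (hΓ : ∀ l a b, Γ l a b = Γ l b a) (hdd : ∀ a b c, ddW a b c = ddW b a c)
    (hA : ∀ ν μ, A ν μ = dW ν μ + ∑ ρ, Γ μ ν ρ * W ρ)
    (hdA : ∀ κ ν μ, dA κ ν μ = ddW κ ν μ + ∑ ρ, (dΓ κ μ ν ρ * W ρ + Γ μ ν ρ * dW κ ρ))
    (κ ν l : Fin 4) :
    hpE Γ A dA κ ν l - hpE Γ A dA ν κ l = ∑ σ, (dΓ κ l ν σ - dΓ ν l κ σ
      + (∑ ρ, Γ l κ ρ * Γ ρ ν σ) - ∑ ρ, Γ l ν ρ * Γ ρ κ σ) * W σ := by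
  have h1 : ∑ ρ, Γ ρ κ ν * A ρ l = ∑ ρ, Γ ρ ν κ * A ρ l :=
    Finset.sum_congr rfl (fun ρ _ => by rw [hΓ ρ κ ν])
  simp only [hpE]
  rw [h1, hdA κ ν l, hdA ν κ l, hdd κ ν l]
  simp only [hA, Fin.sum_univ_four]
  ring

theorem hp_assemble (Γ : Fin 4 → Fin 4 → Fin 4 → ℝ) (N A B : Fin 4 → Fin 4 → ℝ)
    (dA dB : Fin 4 → Fin 4 → Fin 4 → ℝ) (W : Fin 4 → ℝ)
    (R : Fin 4 → Fin 4 → Fin 4 → Fin 4 → ℝ)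
    (hN : ∀ a b, N a b = N b a)
    (hEC : ∀ κ ν μ, hpE Γ A dA κ ν μ = ∑ α, N μ α * hpC Γ B dB κ ν α)
    (hRic : ∀ κ ν l, hpE Γ A dA κ ν l - hpE Γ A dA ν κ l = ∑ σ, R l σ κ ν * W σ)
    (μ : Fin 4) :
    ∑ κ, ∑ ν, N κ ν * hpC Γ B dB κ ν μ = (∑ σ, (∑ κ, R κ σ κ μ) * W σ)
      + (∑ l, ∑ κ, N l κ * (hpC Γ B dB κ l μ - hpC Γ B dB κ μ l)) + ∑ κ, dA μ κ κ := by
  have h1 : ∑ κ, dA μ κ κ = ∑ κ, hpE Γ A dA μ κ κ := by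
    simp only [hpE, Fin.sum_univ_four]
    ring
  have h2 : ∑ σ, (∑ κ, R κ σ κ μ) * W σ = ∑ κ, (hpE Γ A dA κ μ κ - hpE Γ A dA μ κ κ) := by
    simp only [hRic, Finset.sum_mul]
    exact Finset.sum_comm
  have h3 : ∑ κ, hpE Γ A dA κ μ κ = ∑ l, ∑ κ, N l κ * hpC Γ B dB κ μ l := by
    simp only [hEC]
    rw [Finset.sum_comm]
    exact Finset.sum_congr rfl (fun l _ => Finset.sum_congr rfl (fun κ _ => by rw [hN]))
  have h4 : ∑ κ, ∑ ν, N κ ν * hpC Γ B dB κ ν μ = ∑ l, ∑ κ, N l κ * hpC Γ B dB κ l μ := by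
    rw [Finset.sum_comm]
    exact Finset.sum_congr rfl (fun l _ => Finset.sum_congr rfl (fun κ _ => by rw [hN]))
  rw [h1, h2, h4, Finset.sum_sub_distrib, h3]
  simp only [mul_sub, Finset.sum_sub_distrib]
  ring

theorem hp_box_alg (Γ : Fin 4 → Fin 4 → Fin 4 → ℝ) (N A B : Fin 4 → Fin 4 → ℝ)
    (dB : Fin 4 → Fin 4 → Fin 4 → ℝ) (W : Fin 4 → ℝ)
    (dW : Fin 4 → Fin 4 → ℝ) (hA : ∀ ν μ, A ν μ = dW ν μ + ∑ ρ, Γ μ ν ρ * W ρ)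
    (hN : ∀ a b, N a b = N b a) :
    ∑ κ, ∑ ν, N κ ν * ((-2 * ∑ μ, (dW κ μ * B ν μ + W μ * dB κ ν μ))
        - ∑ l, Γ l κ ν * (-2 * ∑ μ, W μ * B l μ))
      = -2 * (∑ ν, ∑ μ, B ν μ * ∑ κ, N ν κ * A κ μ)
        - 2 * ∑ μ, W μ * ∑ κ, ∑ ν, N κ ν * hpC Γ B dB κ ν μ := by
  have key : ∀ κ ν, ((-2 * ∑ μ, (dW κ μ * B ν μ + W μ * dB κ ν μ))
        - ∑ l, Γ l κ ν * (-2 * ∑ μ, W μ * B l μ))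
      = -2 * (∑ μ, B ν μ * A κ μ) - 2 * ∑ μ, W μ * hpC Γ B dB κ ν μ := by
    intro κ ν
    simp only [hA, hpC, Fin.sum_univ_four]
    ring
  simp only [key]
  have e1 : ∑ ν, ∑ μ, B ν μ * ∑ κ, N ν κ * A κ μ
      = ∑ κ, ∑ ν, N κ ν * ∑ μ, B ν μ * A κ μ := by
    rw [Finset.sum_comm (f := fun κ ν => N κ ν * ∑ μ, B ν μ * A κ μ)]
    refine Finset.sum_congr rfl (fun ν _ => ?_)
    simp only [Finset.mul_sum]
    rw [Finset.sum_comm]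
    refine Finset.sum_congr rfl (fun κ _ => Finset.sum_congr rfl (fun μ _ => ?_))
    rw [hN ν κ]; ring
  have e2 : ∑ μ, W μ * ∑ κ, ∑ ν, N κ ν * hpC Γ B dB κ ν μ
      = ∑ κ, ∑ ν, N κ ν * ∑ μ, W μ * hpC Γ B dB κ ν μ := by
    simp only [Finset.mul_sum]
    rw [Finset.sum_comm]
    refine Finset.sum_congr rfl (fun κ _ => ?_)
    rw [Finset.sum_comm]
    refine Finset.sum_congr rfl (fun ν _ => Finset.sum_congr rfl (fun μ _ => ?_))
    ring
  rw [e1, e2]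
  simp only [mul_sub, Finset.sum_sub_distrib, Finset.mul_sum]
  congr 1 <;>
  exact Finset.sum_congr rfl (fun _ _ => Finset.sum_congr rfl (fun _ _ =>
    Finset.sum_congr rfl (fun _ _ => by ring)))

/-- The wave equation for ‖V‖² (Section 1.3.1):
□‖V‖² = −2(∇_ν V_μ)(∇^ν V^μ) − 2V^μ[R_{σμ}V^σ + ∇^λω_{λμ} − (1/G)(∇_μ(D_V G) + (∇_ν V^ν)(∇_μ G))],
under the continuity equation ∇_μ(G V^μ) = 0. -/
theorem wave_equation_normSq
    (U : Set Vec4) (hU : IsOpen U)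
    (g ginv : Vec4 → Fin 4 → Fin 4 → ℝ)
    (hsymm : ∀ x ∈ U, ∀ μ ν, g x μ ν = g x ν μ)
    (hinv : ∀ x ∈ U, ∀ μ ν, (∑ κ, g x μ κ * ginv x κ ν) = if μ = ν then 1 else 0)
    (hg : ∀ μ ν, ContDiffOn ℝ 3 (fun x => g x μ ν) U)
    (V : Vec4 → Fin 4 → ℝ)
    (hV : ∀ μ, ContDiffOn ℝ 3 (fun x => V x μ) U)
    (G : Vec4 → ℝ) (hG : ContDiffOn ℝ 2 G U) (hGpos : ∀ x ∈ U, 0 < G x)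
    (hcont : ∀ x ∈ U, DVf ginv V G x + G x * divUp g ginv V x = 0) :
    ∀ x ∈ U,
      box g ginv (normSq ginv V) x
        = -2 * (∑ ν, ∑ μ, covD g ginv V ν μ x * covDupUp g ginv V ν μ x)
          - 2 * ∑ μ, Vup ginv V μ x *
              ((∑ σ, RicciT g ginv σ μ x * Vup ginv V σ x)
                + divVort g ginv V μ x
                - (1 / G x) *
                    (pd μ (fun y => DVf ginv V G y) x + divUp g ginv V x * pd μ G x)) := by
  have hsmall : ∀ {f : Vec4 → ℝ} {n : WithTop ℕ∞}, ContDiffOn ℝ n f U → n ≠ 0 → ∀ y ∈ U,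
      DifferentiableAt ℝ f y := fun hf hn y hy =>
    (hf.contDiffAt (hU.mem_nhds hy)).differentiableAt hn
  have hMN : ∀ y ∈ U, (Matrix.of (g y)) * (Matrix.of (ginv y)) = 1 := by
    intro y hy
    ext a b
    simp only [Matrix.mul_apply, Matrix.of_apply, Matrix.one_apply]
    exact hinv y hy a b
  have hMt : ∀ y ∈ U, (Matrix.of (g y)).transpose = Matrix.of (g y) := by
    intro y hy
    ext a b
    exact hsymm y hy b a
  have hNs : ∀ y ∈ U, ∀ a b, ginv y a b = ginv y b a := by
    intro y hy a b
    have h1 := Matrix.inv_eq_right_inv (hMN y hy)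
    have h2 : (Matrix.of (ginv y)).transpose = Matrix.of (ginv y) := by
      rw [← h1, Matrix.transpose_nonsing_inv, hMt y hy]
    exact congrFun (congrFun h2 b) a
  have hgi : ∀ μ ν, ContDiffOn ℝ 3 (fun x => ginv x μ ν) U := hp_ginv_contDiffOn hMN hg
  have hW : ∀ μ, ContDiffOn ℝ 3 (fun y => Vup ginv V μ y) U := fun μ => by
    simp only [Vup]
    exact ContDiffOn.sum (fun ν _ => (hgi μ ν).mul (hV ν))
  have hGam : ∀ l μ ν, ContDiffOn ℝ 2 (fun y => Chris g ginv l μ ν y) U := fun l μ ν => by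
    simp only [Chris]
    refine contDiffOn_const.mul (ContDiffOn.sum (fun κ _ => ?_))
    refine ((hgi l κ).of_le (by norm_num)).mul ?_
    exact ((hp_pd_contDiffOn hU (hg _ _) (by norm_num) _).add
      (hp_pd_contDiffOn hU (hg _ _) (by norm_num) _)).sub
      (hp_pd_contDiffOn hU (hg _ _) (by norm_num) _)
  have hBc : ∀ ν μ, ContDiffOn ℝ 2 (fun y => covD g ginv V ν μ y) U := fun ν μ => by
    simp only [covD]
    exact (hp_pd_contDiffOn hU (hV _) (by norm_num) _).sub
      (ContDiffOn.sum (fun κ _ => (hGam _ _ _).mul ((hV κ).of_le (by norm_num))))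
  have hAc : ∀ ν μ, ContDiffOn ℝ 2 (fun y => hpA g ginv V ν μ y) U := fun ν μ => by
    simp only [hpA]
    exact (hp_pd_contDiffOn hU (hW _) (by norm_num) _).add
      (ContDiffOn.sum (fun κ _ => (hGam _ _ _).mul ((hW κ).of_le (by norm_num))))
  have dgi : ∀ y ∈ U, ∀ a b, DifferentiableAt ℝ (fun z => ginv z a b) y :=
    fun y hy a b => hsmall (hgi a b) (by norm_num) y hy
  have dg : ∀ y ∈ U, ∀ a b, DifferentiableAt ℝ (fun z => g z a b) y :=
    fun y hy a b => hsmall (hg a b) (by norm_num) y hy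
  have dV : ∀ y ∈ U, ∀ a, DifferentiableAt ℝ (fun z => V z a) y :=
    fun y hy a => hsmall (hV a) (by norm_num) y hy
  have dW : ∀ y ∈ U, ∀ a, DifferentiableAt ℝ (fun z => Vup ginv V a z) y :=
    fun y hy a => hsmall (hW a) (by norm_num) y hy
  have dB : ∀ y ∈ U, ∀ a b, DifferentiableAt ℝ (fun z => covD g ginv V a b z) y :=
    fun y hy a b => hsmall (hBc a b) (by norm_num) y hy
  have dA : ∀ y ∈ U, ∀ a b, DifferentiableAt ℝ (fun z => hpA g ginv V a b z) y :=
    fun y hy a b => hsmall (hAc a b) (by norm_num) y hy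
  have dΓ : ∀ y ∈ U, ∀ l a b, DifferentiableAt ℝ (fun z => Chris g ginv l a b z) y :=
    fun y hy l a b => hsmall (hGam l a b) (by norm_num) y hy
  have hdgs : ∀ y ∈ U, ∀ a b c, pd a (fun z => g z b c) y = pd a (fun z => g z c b) y :=
    fun y hy a b c => hp_pd_congr hU (fun z hz => hsymm z hz b c) hy a
  have hΓs : ∀ y ∈ U, ∀ l a b, Chris g ginv l a b y = Chris g ginv l b a y := by
    intro y hy l a b
    simp only [Chris]
    congr 1
    refine Finset.sum_congr rfl (fun κ _ => ?_)
    rw [hdgs y hy κ a b]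
    ring
  -- derivative of the inverse metric
  have hdN : ∀ y ∈ U, ∀ κ μ ν, pd κ (fun z => ginv z μ ν) y
      = - (∑ l, Chris g ginv μ κ l y * ginv y l ν) - ∑ l, ginv y μ l * Chris g ginv ν κ l y := by
    intro y hy κ μ ν
    have hc := hp_compat (Matrix.of (g y)) (Matrix.of (ginv y)) (hMN y hy)
      (fun a b c => pd a (fun z => g z b c) y) (hdgs y hy)
      (fun l a b => Chris g ginv l a b y) (fun l a b => rfl) κ
    have hd : Matrix.of (fun b c => pd κ (fun z => g z b c) y) * Matrix.of (ginv y)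
        + Matrix.of (g y) * Matrix.of (fun b c => pd κ (fun z => ginv z b c) y) = 0 := by
      ext a b
      have h1 := hp_pd_congr hU (h := fun _ => if a = b then (1 : ℝ) else 0)
        (fun z hz => hinv z hz a b) hy κ
      rw [hp_pd_sum_mul κ (fun i => dg y hy a i) (fun i => dgi y hy i b)] at h1
      have h2 : pd κ (fun _ : Vec4 => if a = b then (1 : ℝ) else 0) y = 0 := by
        simp [pd]
      rw [h2, Finset.sum_add_distrib] at h1
      simpa only [Matrix.add_apply, Matrix.mul_apply, Matrix.of_apply, Matrix.zero_apply] using h1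
    have h3 := hp_compat_inv _ _ _ _ _ (hMN y hy) (hMt y hy) hd hc
    have h4 := congrFun (congrFun h3 μ) ν
    simpa only [Matrix.sub_apply, Matrix.neg_apply, Matrix.mul_apply, Matrix.of_apply,
      Matrix.transpose_apply] using h4
  have hAB : ∀ y ∈ U, ∀ ν μ, hpA g ginv V ν μ y = ∑ α, ginv y μ α * covD g ginv V ν α y := by
    intro y hy ν μ
    have h1 : pd ν (fun z => Vup ginv V μ z) y
        = ∑ α, (pd ν (fun z => ginv z μ α) y * V y α + ginv y μ α * pd ν (fun z => V z α) y) :=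
      hp_pd_sum_mul ν (fun i => dgi y hy μ i) (fun i => dV y hy i)
    unfold hpA
    rw [h1]
    simp only [hdN y hy, covD, Vup, Fin.sum_univ_four]
    ring
  have hn1 : ∀ y ∈ U, ∀ ν, pd ν (normSq ginv V) y
      = -2 * ∑ μ, Vup ginv V μ y * covD g ginv V ν μ y := by
    intro y hy ν
    have h0 : pd ν (normSq ginv V) y = pd ν (fun z => (-1) * ∑ μ, Vup ginv V μ z * V z μ) y := by
      apply hp_pd_congr hU _ hy
      intro z hz
      simp only [normSq, Vup]
      rw [neg_one_mul, Finset.sum_comm]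
      congr 1
      refine Finset.sum_congr rfl (fun a _ => ?_)
      rw [Finset.sum_mul]
      refine Finset.sum_congr rfl (fun b _ => ?_)
      rw [hNs z hz a b]
    rw [h0, hp_pd_const_mul ν _ (DifferentiableAt.fun_sum (fun i _ => (dW y hy i).fun_mul (dV y hy i))),
      hp_pd_sum_mul ν (fun i => dW y hy i) (fun i => dV y hy i)]
    have h1 : ∀ μ, pd ν (fun z => Vup ginv V μ z) y = (∑ α, ginv y μ α * covD g ginv V ν α y)
        - ∑ ρ, Chris g ginv μ ν ρ y * Vup ginv V ρ y := by
      intro μ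
      rw [← hAB y hy]; simp only [hpA]; ring
    have h2 : ∀ μ, pd ν (fun z => V z μ) y = covD g ginv V ν μ y
        + ∑ κ, Chris g ginv κ ν μ y * V y κ := by
      intro μ
      simp only [covD]; ring
    have h3 : ∑ μ, (∑ α, ginv y μ α * covD g ginv V ν α y) * V y μ
        = ∑ μ, Vup ginv V μ y * covD g ginv V ν μ y := by
      simp only [Vup, Finset.sum_mul]
      rw [Finset.sum_comm]
      refine Finset.sum_congr rfl (fun a _ => Finset.sum_congr rfl (fun b _ => ?_))
      rw [hNs y hy a b]; ring
    have h4 : ∑ μ, (∑ ρ, Chris g ginv μ ν ρ y * Vup ginv V ρ y) * V y μ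
        = ∑ μ, Vup ginv V μ y * ∑ κ, Chris g ginv κ ν μ y * V y κ := by
      simp only [Finset.sum_mul, Finset.mul_sum]
      rw [Finset.sum_comm]
      refine Finset.sum_congr rfl (fun a _ => Finset.sum_congr rfl (fun b _ => ?_))
      ring
    simp only [h1, h2, sub_mul, mul_add, Finset.sum_add_distrib, Finset.sum_sub_distrib]
    rw [h3, h4]
    ring
  intro x hx
  have hn2 : ∀ κ ν, pd κ (pd ν (normSq ginv V)) x
      = -2 * ∑ μ, (pd κ (fun y => Vup ginv V μ y) x * covD g ginv V ν μ x
        + Vup ginv V μ x * pd κ (fun y => covD g ginv V ν μ y) x) := by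
    intro κ ν
    rw [hp_pd_congr hU (fun y hy => hn1 y hy ν) hx κ,
      hp_pd_const_mul κ _ (DifferentiableAt.fun_sum (fun i _ => (dW x hx i).fun_mul (dB x hx ν i))),
      hp_pd_sum_mul κ (fun i => dW x hx i) (fun i => dB x hx ν i)]
  have hω : ∀ y ∈ U, ∀ a b, vort V a b y = covD g ginv V a b y - covD g ginv V b a y := by
    intro y hy a b
    simp only [vort, covD, fun κ => hΓs y hy κ b a]
    ring
  have hdω : ∀ κ a b, pd κ (fun y => vort V a b y) x
      = pd κ (fun y => covD g ginv V a b y) x - pd κ (fun y => covD g ginv V b a y) x := by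
    intro κ a b
    rw [hp_pd_congr hU (fun y hy => hω y hy a b) hx κ, hp_pd_sub κ (dB x hx a b) (dB x hx b a)]
  have hdA1 : ∀ κ ν μ, pd κ (fun y => hpA g ginv V ν μ y) x
      = ∑ α, (pd κ (fun y => ginv y μ α) x * covD g ginv V ν α x
        + ginv x μ α * pd κ (fun y => covD g ginv V ν α y) x) := by
    intro κ ν μ
    rw [hp_pd_congr hU (fun y hy => hAB y hy ν μ) hx κ,
      hp_pd_sum_mul κ (fun i => dgi x hx μ i) (fun i => dB x hx ν i)]
  have hdA2 : ∀ κ ν μ, pd κ (fun y => hpA g ginv V ν μ y) x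
      = pd κ (pd ν (fun y => Vup ginv V μ y)) x
        + ∑ ρ, (pd κ (fun y => Chris g ginv μ ν ρ y) x * Vup ginv V ρ x
          + Chris g ginv μ ν ρ x * pd κ (fun y => Vup ginv V ρ y) x) := by
    intro κ ν μ
    rw [← hp_pd_sum_mul κ (fun i => dΓ x hx μ ν i) (fun i => dW x hx i)]
    exact hp_pd_add κ (hsmall (hp_pd_contDiffOn hU (m := 2) (hW μ) (by norm_num) ν) (by norm_num) x hx)
      (DifferentiableAt.fun_sum (fun i _ => (dΓ x hx μ ν i).fun_mul (dW x hx i)))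
  have hddiv : ∀ μ, pd μ (fun y => divUp g ginv V y) x
      = ∑ κ, pd μ (fun y => hpA g ginv V κ κ y) x := fun μ =>
    hp_pd_sum μ (fun i => dA x hx i i)
  have hdivd : DifferentiableAt ℝ (fun y => divUp g ginv V y) x :=
    DifferentiableAt.fun_sum (fun i _ => dA x hx i i)
  have hGt : ∀ μ, (1 / G x) *
      (pd μ (fun y => DVf ginv V G y) x + divUp g ginv V x * pd μ G x)
      = - ∑ κ, pd μ (fun y => hpA g ginv V κ κ y) x := by
    intro μ
    have hGd : DifferentiableAt ℝ G x := hsmall hG (by norm_num) x hx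
    have h1 : ∀ y ∈ U, DVf ginv V G y = (-1) * (G y * divUp g ginv V y) := fun y hy => by
      linarith [hcont y hy]
    rw [hp_pd_congr hU h1 hx μ, hp_pd_const_mul μ _ (hGd.fun_mul hdivd), hp_pd_mul μ hGd hdivd,
      ← hddiv μ]
    have := (hGpos x hx).ne'
    field_simp
    ring
  have hEC := hp_E_eq_C (fun l a b => Chris g ginv l a b x) (ginv x)
    (fun a b => hpA g ginv V a b x) (fun a b => covD g ginv V a b x)
    (fun κ a b => pd κ (fun y => hpA g ginv V a b y) x)
    (fun κ a b => pd κ (fun y => covD g ginv V a b y) x)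
    (fun κ a b => pd κ (fun y => ginv y a b) x) (hAB x hx) hdA1 (hdN x hx)
  have hRic := hp_ricci_identity (fun l a b => Chris g ginv l a b x) (fun a => Vup ginv V a x)
    (fun a b => hpA g ginv V a b x) (fun a b => pd a (fun y => Vup ginv V b y) x)
    (fun κ a b => pd κ (fun y => hpA g ginv V a b y) x)
    (fun κ a b => pd κ (pd a (fun y => Vup ginv V b y)) x)
    (fun κ l a b => pd κ (fun y => Chris g ginv l a b y) x)
    (hΓs x hx) (fun a b c => hp_pd_comm hU ((hW c).of_le (by norm_num)) hx a b)
    (fun _ _ => rfl) hdA2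
  have hfin := hp_assemble (fun l a b => Chris g ginv l a b x) (ginv x)
    (fun a b => hpA g ginv V a b x) (fun a b => covD g ginv V a b x)
    (fun κ a b => pd κ (fun y => hpA g ginv V a b y) x)
    (fun κ a b => pd κ (fun y => covD g ginv V a b y) x) (fun a => Vup ginv V a x)
    (fun l σ a b => Riem g ginv l σ a b x) (hNs x hx) hEC hRic
  have hbox := hp_box_alg (fun l a b => Chris g ginv l a b x) (ginv x)
    (fun a b => hpA g ginv V a b x) (fun a b => covD g ginv V a b x)
    (fun κ a b => pd κ (fun y => covD g ginv V a b y) x) (fun a => Vup ginv V a x)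
    (fun a b => pd a (fun y => Vup ginv V b y) x) (fun _ _ => rfl) (hNs x hx)
  have hdv : ∀ μ, divVort g ginv V μ x = ∑ l, ∑ κ, ginv x l κ *
      (hpC (fun l a b => Chris g ginv l a b x) (fun a b => covD g ginv V a b x)
          (fun κ a b => pd κ (fun y => covD g ginv V a b y) x) κ l μ
        - hpC (fun l a b => Chris g ginv l a b x) (fun a b => covD g ginv V a b x)
          (fun κ a b => pd κ (fun y => covD g ginv V a b y) x) κ μ l) := by
    intro μ
    simp only [divVort]
    refine Finset.sum_congr rfl (fun l _ => Finset.sum_congr rfl (fun κ _ => ?_))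
    congr 1
    simp only [hpC, hdω, hω x hx, mul_sub, Finset.sum_sub_distrib]
    ring
  simp only [box, hn2, hn1 x hx]
  refine hbox.trans ?_
  congr 1
  congr 1
  refine Finset.sum_congr rfl (fun μ _ => ?_)
  rw [hfin μ, hGt μ, hdv μ]
  simp only [RicciT]
  ring
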